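/- Fix integers w ≥ 1, l ≥ 1 and m ≥ 0, and for real q > 1 define a_q := 1 - ∏_{h=1}^{w} (1 - q^{-h}). Then q · [1 - (1 - a_q)^{l} · (1 - l·a_q)^{m}] tends to l·(1 + m) as q tends to infinity. -/

import Mathlib

open Filter

/-- If `q * (1 - f q)` converges as `q → ∞`, then `f` tends to `1`. -/
lemma tendsto_one_of_tendsto_mul_one_sub {f : ℝ → ℝ} {c : ℝ}
    (hf : Tendsto (fun q : ℝ => q * (1 - f q)) atTop (nhds c)) :
    Tendsto f atTop (nhds 1) := by
  have h := (tendsto_inv_atTop_zero (𝕜 := ℝ)).mul hf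
  have h' := h.const_sub 1
  rw [zero_mul, sub_zero] at h'
  refine h'.congr' ?_
  filter_upwards [eventually_gt_atTop 0] with q hq
  field_simp
  ring

lemma tendsto_mul_one_sub_mul {f g : ℝ → ℝ} {c d : ℝ}
    (hf : Tendsto (fun q : ℝ => q * (1 - f q)) atTop (nhds c))
    (hg : Tendsto (fun q : ℝ => q * (1 - g q)) atTop (nhds d)) :
    Tendsto (fun q : ℝ => q * (1 - f q * g q)) atTop (nhds (c + d)) := by
  have h := hf.add ((tendsto_one_of_tendsto_mul_one_sub hf).mul hg)
  rw [one_mul] at h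
  exact h.congr fun q => by ring

lemma tendsto_mul_one_sub_prod {ι : Type*} (s : Finset ι) {f : ι → ℝ → ℝ} {c : ι → ℝ}
    (hf : ∀ i ∈ s, Tendsto (fun q : ℝ => q * (1 - f i q)) atTop (nhds (c i))) :
    Tendsto (fun q : ℝ => q * (1 - ∏ i ∈ s, f i q)) atTop (nhds (∑ i ∈ s, c i)) := by
  classical
  induction s using Finset.induction_on with
  | empty => simp
  | insert i s hi ih =>
    simp only [Finset.prod_insert hi, Finset.sum_insert hi]
    exact tendsto_mul_one_sub_mul (hf i (Finset.mem_insert_self i s))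
      (ih fun j hj => hf j (Finset.mem_insert_of_mem hj))

lemma tendsto_mul_one_sub_pow {f : ℝ → ℝ} {c : ℝ} (n : ℕ)
    (hf : Tendsto (fun q : ℝ => q * (1 - f q)) atTop (nhds c)) :
    Tendsto (fun q : ℝ => q * (1 - f q ^ n)) atTop (nhds (n * c)) := by
  simpa using tendsto_mul_one_sub_prod (Finset.range n) (fun _ _ => hf)

lemma tendsto_mul_inv_pow_succ (h : ℕ) :
    Tendsto (fun q : ℝ => q * (1 - (1 - (q ^ (h + 1))⁻¹))) atTop
      (nhds (if h = 0 then 1 else 0)) := by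
  have key : Tendsto (fun q : ℝ => (q⁻¹) ^ h) atTop (nhds (if h = 0 then 1 else 0)) := by
    simpa [zero_pow_eq] using (tendsto_inv_atTop_zero (𝕜 := ℝ)).pow h
  refine key.congr' ?_
  filter_upwards [eventually_gt_atTop 0] with q hq
  rw [pow_succ, sub_sub_cancel, inv_pow]
  field_simp

/-- With `a_q = 1 - ∏_{h=1}^{w}(1 - q^{-h})`, for fixed `w ≥ 1`, `l ≥ 1` and `m ≥ 0`,
the quantity `q·[1 - (1 - a_q)^l (1 - l·a_q)^m]` tends to `l·(1 + m)` as `q → ∞`. -/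
theorem tendsto_failure_bound_internal_nodes
    (w l m : ℕ) (hw : 1 ≤ w) (hl : 1 ≤ l) (a : ℝ → ℝ)
    (ha : ∀ q : ℝ, 1 < q → a q = 1 - ∏ h ∈ Finset.range w, (1 - (q ^ (h + 1))⁻¹)) :
    Tendsto
      (fun q : ℝ => q * (1 - (1 - a q) ^ l * (1 - (l : ℝ) * a q) ^ m))
      atTop (nhds ((l : ℝ) * (1 + (m : ℝ)))) := by
  have hlim : Tendsto (fun q : ℝ => q * a q) atTop (nhds 1) := by
    have h := tendsto_mul_one_sub_prod (Finset.range w) fun h _ => tendsto_mul_inv_pow_succ h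
    rw [Finset.sum_ite_eq', if_pos (Finset.mem_range.mpr hw)] at h
    refine h.congr' ?_
    filter_upwards [eventually_gt_atTop 1] with q hq
    rw [ha q hq]
  have h₁ : Tendsto (fun q : ℝ => q * (1 - (1 - a q))) atTop (nhds 1) := by
    simpa using hlim
  have h₂ : Tendsto (fun q : ℝ => q * (1 - (1 - (l : ℝ) * a q))) atTop (nhds l) := by
    simpa [mul_left_comm] using hlim.const_mul (l : ℝ)
  have h := tendsto_mul_one_sub_mul (tendsto_mul_one_sub_pow l h₁) (tendsto_mul_one_sub_pow m h₂)
  convert h using 2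
  ring
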